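/- arXiv:1510.07661 — 3 statements merged into one kernel-verified Lean document; each statement's English description precedes it below -/
import Mathlib

section
/- Let p be an odd prime and let φ be the quadratic character of F_p^×, with values in ℂ_p. Then for every λ ∈ F_p^× and every integer lift λ̂ of λ, (−1)^{(p−1)/2} · ₂F₁(1/2, 1/2; 1 | λ̂)_{tr(p)} ≡ −φ(−1)·p · ₂F₁(φ, φ; ε | λ)_p (mod p), the congruence holding in the valuation ring of ℂ_p. -/
/-- Greene's normalized Jacobi sum `binom(A,B) = B(-1)/q · ∑ₓ A(x) B̄(1-x)`. -/
noncomputable def jacB {F K : Type*} [Field F] [Fintype F] [Field K]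
    (A B : MulChar F K) : K :=
  B (-1) / (Fintype.card F : K) * ∑ x : F, A x * B⁻¹ (1 - x)

/-- Greene's finite field hypergeometric function `₂F₁(A, B; C | x)`. -/
noncomputable def greene2F1 {F K : Type*} [Field F] [Fintype F] [Field K]
    (A B C : MulChar F K) (x : F) : K :=
  (Fintype.card F : K) / ((Fintype.card F : K) - 1) *
    ∑ᶠ χ : MulChar F K, jacB (A * χ) χ * jacB (B * χ) (C * χ) * χ x

/-- The rising factorial (Pochhammer symbol) `(a)ₙ = a(a+1)⋯(a+n-1)` of a rational number. -/
def risingFac (a : ℚ) (n : ℕ) : ℚ :=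
  ∏ i ∈ Finset.range n, (a + i)

section

open Finset

/-- Rewriting of the normalized Jacobi sum `binom(Aχ, χ)` through the substitution `x = 1/(1+a)`. -/
lemma jacB_mul_self {F K : Type*} [Field F] [Fintype F] [Field K] (A χ : MulChar F K) :
    jacB (A * χ) χ =
      χ (-1) / (Fintype.card F : K) * ∑ a : F, A⁻¹ (1 + a) * χ⁻¹ a := by
  unfold jacB
  congr 1
  trans ∑ w : F, A⁻¹ w * χ⁻¹ (w - 1)
  · rw [← Equiv.sum_comp (Equiv.inv F)]
    refine Fintype.sum_congr _ _ fun w => ?_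
    rcases eq_or_ne w 0 with rfl | hw
    · simp [MulChar.map_zero]
    · simp only [Equiv.inv_apply, MulChar.mul_apply, MulChar.inv_apply']
      rw [mul_assoc, ← map_mul, ← mul_inv, mul_sub, mul_inv_cancel₀ hw, mul_one]
  · rw [← Equiv.sum_comp (Equiv.addLeft (1 : F))]
    exact Fintype.sum_congr _ _ fun a => by simp

/-- Character-free form of Greene's `₂F₁(A, B; ε | x)` over `ZMod p`. -/
lemma card_mul_greene2F1_one {p : ℕ} [Fact p.Prime] {K : Type*} [Field K] [CharZero K]
    [IsAlgClosed K] (A B : MulChar (ZMod p) K) {x : ZMod p} (hx : x ≠ 0) :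
    (p : K) * greene2F1 A B 1 x =
      ∑ a : (ZMod p)ˣ, A⁻¹ (1 + a) * B⁻¹ (1 + x * (a : ZMod p)⁻¹) := by
  classical
  have hp : (p : K) ≠ 0 := Nat.cast_ne_zero.mpr (Fact.out : p.Prime).ne_zero
  have hp1 : (p : K) - 1 ≠ 0 :=
    sub_ne_zero.mpr (Nat.cast_ne_one.mpr (Fact.out : p.Prime).ne_one)
  have : NeZero (Monoid.exponent (ZMod p)ˣ) :=
    ⟨Monoid.exponent_ne_zero_of_finite⟩
  have : NeZero ((Monoid.exponent (ZMod p)ˣ : ℕ) : K) :=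
    ⟨Nat.cast_ne_zero.mpr Monoid.exponent_ne_zero_of_finite⟩
  have horth (a b : ZMod p) :
      ∑ χ : DirichletCharacter K p, χ⁻¹ a * χ⁻¹ b * χ x =
        if a * b = x then (p : K) - 1 else 0 := by
    simp_rw [← map_mul, MulChar.inv_apply']
    rcases eq_or_ne (a * b) 0 with h | h
    · simp [h, hx.symm, MulChar.map_zero]
    · rw [DirichletCharacter.sum_char_inv_mul_char_eq K h.isUnit,
        Nat.totient_prime Fact.out, Nat.cast_sub (Fact.out : p.Prime).one_le, Nat.cast_one]
  have hterm (χ : DirichletCharacter K p) :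
      jacB (A * χ) χ * jacB (B * χ) (1 * χ) * χ x =
        ((p : K) ^ 2)⁻¹ * ∑ a : ZMod p, ∑ b : ZMod p,
          A⁻¹ (1 + a) * B⁻¹ (1 + b) * (χ⁻¹ a * χ⁻¹ b * χ x) := by
    have h1 : χ (-1) * χ (-1) = 1 := by rw [← map_mul]; simp
    rw [one_mul, jacB_mul_self, jacB_mul_self, ZMod.card]
    calc _ = (χ (-1) * χ (-1)) * ((p : K) ^ 2)⁻¹ * (((∑ a, A⁻¹ (1 + a) * χ⁻¹ a) *
            ∑ b, B⁻¹ (1 + b) * χ⁻¹ b) * χ x) := by field_simp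
      _ = _ := by
        rw [h1, one_mul, sum_mul_sum, sum_mul]
        simp_rw [sum_mul]
        congr 1
        exact Fintype.sum_congr _ _ fun a => Fintype.sum_congr _ _ fun b => by ring
  have hsum : ∑ᶠ χ : MulChar (ZMod p) K, jacB (A * χ) χ * jacB (B * χ) (1 * χ) * χ x =
      ((p : K) ^ 2)⁻¹ * ((p : K) - 1) * ∑ a : ZMod p, ∑ b : ZMod p,
        if a * b = x then A⁻¹ (1 + a) * B⁻¹ (1 + b) else 0 := by
    have := finsum_eq_sum_of_fintype (fun χ : DirichletCharacter K p =>
      jacB (A * χ) χ * jacB (B * χ) (1 * χ) * χ x)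
    refine this.trans ?_
    simp_rw [hterm]
    rw [← mul_sum, sum_comm, mul_assoc]
    congr 1
    rw [mul_sum]
    refine Fintype.sum_congr _ _ fun a => ?_
    rw [sum_comm, mul_sum]
    refine Fintype.sum_congr _ _ fun b => ?_
    rw [← mul_sum, horth]
    split_ifs <;> ring
  have hunits : ∑ a : ZMod p, (∑ b : ZMod p,
        if a * b = x then A⁻¹ (1 + a) * B⁻¹ (1 + b) else 0) =
      ∑ a : (ZMod p)ˣ, A⁻¹ (1 + a) * B⁻¹ (1 + x * (a : ZMod p)⁻¹) := by
    rw [← Fintype.sum_subtype_add_sum_subtype (fun a : ZMod p => a ≠ 0) _]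
    have h0 : ∑ a : {a : ZMod p // ¬ a ≠ 0}, (∑ b : ZMod p,
        if (a : ZMod p) * b = x then A⁻¹ (1 + (a : ZMod p)) * B⁻¹ (1 + b) else 0) = 0 := by
      refine sum_eq_zero fun a _ => sum_eq_zero fun b _ => if_neg ?_
      rw [not_not.mp a.2, zero_mul]
      exact hx.symm
    rw [h0, add_zero, ← Equiv.sum_comp unitsEquivNeZero]
    refine Fintype.sum_congr _ _ fun a => ?_
    have hab (b : ZMod p) : (a : ZMod p) * b = x ↔ b = x * (a : ZMod p)⁻¹ := by
      rw [eq_mul_inv_iff_mul_eq₀ a.ne_zero, mul_comm]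
    simp only [unitsEquivNeZero_apply_coe, hab, sum_ite_eq', mem_univ, if_true]
  rw [greene2F1, hsum, hunits, ZMod.card]
  field_simp

/-- A character of order two with values in a field of characteristic zero is the quadratic
character. -/
lemma eq_quadraticChar_of_orderOf_eq_two {F K : Type*} [Field F] [Fintype F] [DecidableEq F]
    [Field K] [CharZero K] (hF : ringChar F ≠ 2) {χ : MulChar F K} (hχ : orderOf χ = 2) :
    χ = (quadraticChar F).ringHomComp (Int.castRingHom K) := by
  obtain ⟨g, hg⟩ := IsCyclic.exists_generator (α := Fˣ)
  have key (ψ : MulChar F K) (h1 : ψ ≠ 1) (h2 : ψ ^ 2 = 1) : ψ g = -1 := by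
    have hsq : ψ g ^ 2 = 1 := by
      rw [← MulChar.pow_apply_coe, h2, MulChar.one_apply_coe]
    refine (sq_eq_one_iff.mp hsq).resolve_left fun h => h1 ?_
    rw [MulChar.eq_iff hg, h, MulChar.one_apply_coe]
  rw [MulChar.eq_iff hg, key χ (fun h => by simp [h] at hχ) (hχ ▸ pow_orderOf_eq_one χ), key]
  · exact (MulChar.ringHomComp_ne_one_iff (RingHom.injective_int _)).mpr (quadraticChar_ne_one hF)
  · exact ((quadraticChar_isQuadratic F).comp _).sq_eq_one

/-- Constant term extraction for `(1 + a)^m (1 + x/a)^m` over the units of `ZMod p`. -/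
lemma sum_units_one_add_pow_mul_one_add_mul_inv_pow {p : ℕ} [Fact p.Prime] {m : ℕ}
    (hm : m < p - 1) (x : ZMod p) :
    ∑ a : (ZMod p)ˣ, (1 + (a : ZMod p)) ^ m * (1 + x * (a : ZMod p)⁻¹) ^ m =
      -∑ k ∈ range (m + 1), (m.choose k : ZMod p) ^ 2 * x ^ k := by
  classical
  have hpow (j k : ℕ) (hj : j ∈ range (m + 1)) (hk : k ∈ range (m + 1)) :
      ∑ a : (ZMod p)ˣ, (a : ZMod p) ^ j * ((a : ZMod p)⁻¹) ^ k = if j = k then -1 else 0 := by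
    rw [mem_range] at hj hk
    have h1 (a : (ZMod p)ˣ) : (a : ZMod p) ^ j * ((a : ZMod p)⁻¹) ^ k =
        (a : ZMod p) ^ (j + (p - 1 - k)) := by
      rw [inv_pow, ← div_eq_mul_inv, div_eq_iff (pow_ne_zero _ a.ne_zero), ← pow_add,
        show j + (p - 1 - k) + k = j + (p - 1) by omega, pow_add,
        ZMod.pow_card_sub_one_eq_one a.ne_zero, mul_one]
    simp_rw [h1]
    rw [FiniteField.sum_pow_units, ZMod.card]
    refine if_congr ?_ rfl rfl
    constructor
    · rintro ⟨c, hc⟩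
      rcases c with _ | _ | c
      · omega
      · omega
      · have : 2 * (p - 1) ≤ (p - 1) * (c + 1 + 1) := by nlinarith
        omega
    · rintro rfl
      exact ⟨1, by omega⟩
  have hexp (a : (ZMod p)ˣ) : (1 + (a : ZMod p)) ^ m * (1 + x * (a : ZMod p)⁻¹) ^ m =
      ∑ k ∈ range (m + 1), ∑ j ∈ range (m + 1), (m.choose k * m.choose j * x ^ k : ZMod p) *
        ((a : ZMod p) ^ j * ((a : ZMod p)⁻¹) ^ k) := by
    rw [add_comm 1, add_pow, add_comm 1, add_pow, sum_mul_sum, sum_comm]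
    refine sum_congr rfl fun k _ => sum_congr rfl fun j _ => ?_
    simp only [one_pow, mul_one, mul_pow]
    ring
  simp_rw [hexp]
  rw [sum_comm, ← sum_neg_distrib]
  refine sum_congr rfl fun k hk => ?_
  rw [sum_comm]
  simp_rw [← mul_sum]
  rw [sum_congr rfl fun j hj => by rw [hpow j k hj hk], sum_eq_single_of_mem k hk
    fun j _ hjk => by rw [if_neg hjk, mul_zero], if_pos rfl]
  ring

lemma Padic.norm_intCast_le_inv_of_zmod_eq_zero {p : ℕ} [Fact p.Prime] {z : ℤ}
    (hz : (z : ZMod p) = 0) : ‖(z : ℚ_[p])‖ ≤ (p : ℝ)⁻¹ := by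
  have := (Padic.norm_int_le_pow_iff_dvd (p := p) z 1).mpr
    (by simpa using (ZMod.intCast_zmod_eq_zero_iff_dvd z p).mp hz)
  simpa using this

lemma risingFac_one (k : ℕ) : risingFac 1 k = k.factorial := by
  rw [risingFac, ← prod_range_add_one_eq_factorial]
  push_cast
  exact prod_congr rfl fun i _ => add_comm _ _

lemma two_pow_mul_risingFac_half (k : ℕ) :
    2 ^ k * risingFac (1 / 2) k = ((∏ i ∈ range k, (1 + 2 * (i : ℤ)) : ℤ) : ℚ) := by
  rw [risingFac, ← card_range k, ← prod_const, card_range, ← prod_mul_distrib]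
  push_cast
  exact prod_congr rfl fun i _ => by ring

lemma zmod_sq_prod_odd {p m : ℕ} (hpm : p = 2 * m + 1) (k : ℕ) :
    (∏ i ∈ range k, (1 + 2 * (i : ZMod p))) ^ 2 =
      4 ^ k * (k.factorial : ZMod p) ^ 2 * (m.choose k : ZMod p) ^ 2 := by
  have h0 : (2 * m + 1 : ZMod p) = 0 := by
    have := congrArg (Nat.cast (R := ZMod p)) hpm
    rw [ZMod.natCast_self] at this
    exact_mod_cast this.symm
  have h : (-1) ^ k * ∏ i ∈ range k, (1 + 2 * (i : ZMod p)) =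
      2 ^ k * (k.factorial * m.choose k : ZMod p) := by
    rw [← Nat.cast_mul, ← Nat.descFactorial_eq_factorial_mul_choose]
    induction k with
    | zero => simp
    | succ k ih =>
      rw [prod_range_succ, Nat.descFactorial_succ, pow_succ, pow_succ]
      push_cast
      rcases le_or_gt k m with hk | hk
      · rw [Nat.cast_sub hk]
        linear_combination (-(1 + 2 * (k : ZMod p))) * ih +
          (-(2 ^ k * (m.descFactorial k : ZMod p))) * h0
      · rw [Nat.descFactorial_of_lt hk] at ih ⊢
        linear_combination (-(1 + 2 * (k : ZMod p))) * ih
  have h1 : ((-1 : ZMod p) ^ k) ^ 2 = 1 := by rw [← pow_mul, mul_comm, pow_mul]; simp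
  have h2 := congrArg (· ^ 2) h
  simp only [mul_pow, h1, one_mul] at h2
  rw [h2, show (4 : ZMod p) = 2 ^ 2 by norm_num, ← pow_mul, ← pow_mul, mul_comm k 2]
  ring

/-- The coefficients of `₂F₁(1/2, 1/2; 1 | x)` of index `k < p` reduce mod `p` to squares of
binomial coefficients. -/
lemma norm_hypergeometric_coeff_sub_choose_sq_le {p m k : ℕ} [Fact p.Prime] (hpm : p = 2 * m + 1)
    (hk : k < p) :
    ‖((risingFac (1 / 2) k * risingFac (1 / 2) k / (risingFac 1 k * (k.factorial : ℚ)) -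
      (m.choose k : ℚ) ^ 2 : ℚ) : ℚ_[p])‖ ≤ (p : ℝ)⁻¹ := by
  have hp : p.Prime := Fact.out
  set P : ℤ := ∏ i ∈ range k, (1 + 2 * (i : ℤ)) with hP
  have hnum :
      ((P ^ 2 - 4 ^ k * (k.factorial : ℤ) ^ 2 * (m.choose k : ℤ) ^ 2 : ℤ) : ZMod p) = 0 := by
    rw [hP]
    push_cast
    rw [zmod_sq_prod_odd hpm, sub_self]
  have hden : ‖((4 ^ k * k.factorial ^ 2 : ℕ) : ℚ_[p])‖ = 1 := by
    rw [Padic.norm_natCast_eq_one_iff]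
    refine Nat.Coprime.mul_right (Nat.Coprime.pow_right _ ?_) (Nat.Coprime.pow_right _ ?_)
    · exact Nat.Coprime.pow_right 2 ((Nat.coprime_primes hp Nat.prime_two).mpr (by omega))
    · exact (hp.coprime_iff_not_dvd).mpr fun h => absurd (hp.dvd_factorial.mp h) (by omega)
  have hf : (k.factorial : ℚ) ≠ 0 := by positivity
  have hq : risingFac (1 / 2) k * risingFac (1 / 2) k / (risingFac 1 k * (k.factorial : ℚ)) -
      (m.choose k : ℚ) ^ 2 =
      ((P ^ 2 - 4 ^ k * (k.factorial : ℤ) ^ 2 * (m.choose k : ℤ) ^ 2 : ℤ) : ℚ) /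
        ((4 ^ k * k.factorial ^ 2 : ℕ) : ℚ) := by
    have h2 := two_pow_mul_risingFac_half k
    rw [← hP] at h2
    rw [risingFac_one]
    push_cast
    rw [← h2, show (4 : ℚ) ^ k = (2 ^ k) ^ 2 by rw [← pow_mul, mul_comm, pow_mul]; norm_num]
    field_simp
  rw [hq, Rat.cast_div, norm_div, Rat.cast_natCast, hden, div_one, Rat.cast_intCast]
  exact Padic.norm_intCast_le_inv_of_zmod_eq_zero hnum

end

/-- Corollary 3.2: for `p` an odd prime and `φ` the quadratic character of `F_p^×` with values
in `ℂ_p` (formalized as an algebraically closed complete nontrivially normed field extension `K`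
of `ℚ_p`): for every `λ ∈ F_p^×` with integer lift `λ̂`,
`(-1)^{(p-1)/2} · ₂F₁(1/2, 1/2; 1 | λ̂)_{tr(p)} ≡ -φ(-1)·p · ₂F₁(φ, φ; ε | λ)ₚ (mod p)`,
the congruence holding in the valuation ring (difference of norm at most `1/p`). -/
theorem classical_2F1_congruent_greene_2F1_legendre
    (p : ℕ) [Fact p.Prime] (hodd : p ≠ 2)
    (K : Type*) [NontriviallyNormedField K] [IsAlgClosed K]
    [NormedAlgebra ℚ_[p] K] [CompleteSpace K]
    (φ : MulChar (ZMod p) K) (hφ : orderOf φ = 2)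
    (lam : ZMod p) (hlam : lam ≠ 0) (lamh : ℤ) (hlamh : (lamh : ZMod p) = lam) :
    ‖(((-1 : ℚ) ^ ((p - 1) / 2) *
          ∑ k ∈ Finset.range p,
            risingFac (1/2) k * risingFac (1/2) k /
              (risingFac 1 k * (k.factorial : ℚ)) * (lamh : ℚ) ^ k : ℚ) : K) -
        (-(φ (-1 : ZMod p)) * (p : K) * greene2F1 φ φ 1 lam)‖ ≤ (p : ℝ)⁻¹ := by
  classical
  have hp : p.Prime := Fact.out
  obtain ⟨m, hpm⟩ : ∃ m, p = 2 * m + 1 := hp.odd_of_ne_two hodd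
  have hmp : (p - 1) / 2 = m := by omega
  have hmp' : p / 2 = m := by omega
  have : CharZero K := charZero_of_injective_algebraMap (algebraMap ℚ_[p] K).injective
  have hring : ringChar (ZMod p) ≠ 2 := by rwa [ZMod.ringChar_zmod_n]
  have hquad := eq_quadraticChar_of_orderOf_eq_two hring hφ
  have hφinv : φ⁻¹ = φ := by
    rw [inv_eq_iff_mul_eq_one, ← pow_two, ← hφ, pow_orderOf_eq_one]
  have hφint (a : ZMod p) : φ a = (quadraticChar (ZMod p) a : K) := by rw [hquad]; simp
  have hpow (a : ZMod p) : ((quadraticChar (ZMod p) a : ℤ) : ZMod p) = a ^ m := by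
    rw [quadraticChar_eq_pow_of_char_ne_two' hring, ZMod.card, hmp']
  set S : ℤ := -quadraticChar (ZMod p) (-1) * ∑ a : (ZMod p)ˣ,
    quadraticChar (ZMod p) (1 + a) * quadraticChar (ZMod p) (1 + lam * (a : ZMod p)⁻¹) with hS
  have hright : -(φ (-1 : ZMod p)) * (p : K) * greene2F1 φ φ 1 lam = ((S : ℚ) : K) := by
    rw [mul_assoc, card_mul_greene2F1_one φ φ hlam, hφinv, hS]
    simp only [hφint]
    push_cast
    rfl
  set T : ℤ := (-1) ^ m * ∑ k ∈ Finset.range p, (m.choose k : ℤ) ^ 2 * lamh ^ k with hT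
  have hST : ((T - S : ℤ) : ZMod p) = 0 := by
    have hsub : ∑ k ∈ Finset.range (m + 1), (m.choose k : ZMod p) ^ 2 * lam ^ k =
        ∑ k ∈ Finset.range p, (m.choose k : ZMod p) ^ 2 * lam ^ k := by
      refine Finset.sum_subset (Finset.range_subset_range.mpr (by omega)) fun k _ hk => ?_
      rw [Nat.choose_eq_zero_of_lt (by simpa using hk)]
      simp
    rw [hT, hS]
    push_cast
    simp only [hpow, hlamh]
    rw [sum_units_one_add_pow_mul_one_add_mul_inv_pow (by have := hp.two_le; omega), hsub]
    ring
  rw [hright, ← Rat.cast_sub, ← map_ratCast (algebraMap ℚ_[p] K), norm_algebraMap', hmp]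
  have hsplit : (-1 : ℚ) ^ m * ∑ k ∈ Finset.range p, risingFac (1 / 2) k * risingFac (1 / 2) k /
        (risingFac 1 k * (k.factorial : ℚ)) * (lamh : ℚ) ^ k - (S : ℚ) =
      ∑ k ∈ Finset.range p, (risingFac (1 / 2) k * risingFac (1 / 2) k /
        (risingFac 1 k * (k.factorial : ℚ)) - (m.choose k : ℚ) ^ 2) *
          (((-1) ^ m * lamh ^ k : ℤ) : ℚ) + ((T - S : ℤ) : ℚ) := by
    rw [hT]
    push_cast
    rw [Finset.mul_sum, Finset.mul_sum, ← add_sub_assoc, ← Finset.sum_add_distrib]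
    congr 1
    exact Finset.sum_congr rfl fun k _ => by ring
  rw [hsplit, Rat.cast_add, Rat.cast_sum, Rat.cast_intCast]
  refine (IsUltrametricDist.norm_add_le_max _ _).trans (max_le ?_
    (Padic.norm_intCast_le_inv_of_zmod_eq_zero hST))
  refine IsUltrametricDist.norm_sum_le_of_forall_le_of_nonneg (by positivity) fun k hk => ?_
  rw [Rat.cast_mul, norm_mul, Rat.cast_intCast]
  exact (mul_le_of_le_one_right (norm_nonneg _) (Padic.norm_int_le_one _)).trans
    (norm_hypergeometric_coeff_sub_choose_sq_le hpm (Finset.mem_range.mp hk))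
end

section
/- Let d ≥ 2 be an integer, let p ≡ 1 (mod d) be prime, set t = (p−1)/d, and let T be a generator of the group of multiplicative characters of F_p^× with values in ℂ_p. Then for every x ∈ F_p^× and every integer lift x̂ of x, p^{d−2} · ₍d−1₎F₍d−2₎(T^t, T^{2t}, …, T^{(d−1)t}; ε, …, ε | x)_p ≡ (−1)^d · ₍d−1₎F₍d−2₎(1/d, 2/d, …, (d−1)/d; 1, …, 1 | x̂)_{tr(p)} (mod p), the congruence holding in the valuation ring of ℂ_p. -/
/-- Greene's finite field hypergeometric function `ₙ₊₁Fₙ(A₀,…,Aₙ; B₁,…,Bₙ | x)`. -/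
noncomputable def greeneF {F K : Type*} [Field F] [Fintype F] [Field K] (n : ℕ)
    (A : Fin (n + 1) → MulChar F K) (B : Fin n → MulChar F K) (x : F) : K :=
  (Fintype.card F : K) / ((Fintype.card F : K) - 1) *
    ∑ᶠ χ : MulChar F K,
      (jacB (A 0 * χ) χ * ∏ i : Fin n, jacB (A i.succ * χ) (B i * χ)) * χ x

/-- The Teichmüller lift `F_p → ℤ_p` as a multiplicative character. -/
noncomputable def teichmullerChar (p : ℕ) [Fact p.Prime] : MulChar (ZMod p) ℤ_[p] where
  toMonoidHom := (WittVector.equiv p).toMonoidHom.comp (WittVector.teichmuller p)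
  map_nonunit' a ha := by
    have h : a = 0 := by simpa using ha
    subst h
    change WittVector.equiv p (WittVector.teichmuller p 0) = 0
    rw [WittVector.teichmuller_zero, map_zero]

lemma toZMod_teichmullerChar (p : ℕ) [Fact p.Prime] (a : ZMod p) :
    PadicInt.toZMod (teichmullerChar p a) = a := by
  have hmem : WittVector.teichmuller p a - (a.val : WittVector p (ZMod p)) ∈
      RingHom.ker (WittVector.constantCoeff : WittVector p (ZMod p) →+* ZMod p) := by
    rw [RingHom.mem_ker, map_sub, map_natCast, ZMod.natCast_zmod_val]
    change (WittVector.teichmuller p a).coeff 0 - a = 0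
    rw [WittVector.teichmuller_coeff_zero, sub_self]
  rw [WittVector.ker_constantCoeff, Ideal.mem_span_singleton'] at hmem
  obtain ⟨w, hw⟩ := hmem
  have h := congrArg (fun v => PadicInt.toZMod (WittVector.equiv p v)) hw
  simp only [map_mul, map_natCast, map_sub, CharP.cast_eq_zero, mul_zero,
    ZMod.natCast_zmod_val] at h
  exact sub_eq_zero.mp h.symm

/-- `y ∈ K` is the image of a `p`-adic integer whose residue is `a`. -/
def HasResidue {p : ℕ} [Fact p.Prime] {K : Type*} [NormedField K] [NormedAlgebra ℚ_[p] K]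
    (y : K) (a : ZMod p) : Prop :=
  ∃ z : ℤ_[p], algebraMap ℚ_[p] K z = y ∧ PadicInt.toZMod z = a

namespace HasResidue

variable {p : ℕ} [Fact p.Prime] {K : Type*} [NormedField K] [NormedAlgebra ℚ_[p] K]
  {y y' : K} {a a' : ZMod p}

lemma norm_sub_le (h : HasResidue y a) (h' : HasResidue y' a) : ‖y - y'‖ ≤ (p : ℝ)⁻¹ := by
  obtain ⟨z, rfl, hz⟩ := h
  obtain ⟨z', rfl, hz'⟩ := h'
  rw [← map_sub, norm_algebraMap', ← PadicInt.coe_sub, PadicInt.padic_norm_e_of_padicInt]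
  have hmem : z - z' ∈ RingHom.ker (PadicInt.toZMod (p := p)) := by
    rw [RingHom.mem_ker, map_sub, hz, hz', sub_self]
  rw [PadicInt.ker_toZMod, PadicInt.maximalIdeal_eq_span_p] at hmem
  have := (PadicInt.norm_le_pow_iff_mem_span_pow (z - z') 1).mpr (by simpa using hmem)
  simpa using this

lemma natCast (n : ℕ) : HasResidue (n : K) (n : ZMod p) := ⟨n, by simp, by simp⟩

lemma intCast (n : ℤ) : HasResidue (n : K) (n : ZMod p) := ⟨n, by simp, by simp⟩

lemma one : HasResidue (1 : K) (1 : ZMod p) := ⟨1, by simp, by simp⟩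

lemma zero : HasResidue (0 : K) (0 : ZMod p) := ⟨0, by simp, by simp⟩

lemma add (h : HasResidue y a) (h' : HasResidue y' a') : HasResidue (y + y') (a + a') := by
  obtain ⟨z, rfl, rfl⟩ := h
  obtain ⟨z', rfl, rfl⟩ := h'
  exact ⟨z + z', by simp, by simp⟩

lemma sub (h : HasResidue y a) (h' : HasResidue y' a') : HasResidue (y - y') (a - a') := by
  obtain ⟨z, rfl, rfl⟩ := h
  obtain ⟨z', rfl, rfl⟩ := h'
  exact ⟨z - z', by simp, by simp⟩

lemma mul (h : HasResidue y a) (h' : HasResidue y' a') : HasResidue (y * y') (a * a') := by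
  obtain ⟨z, rfl, rfl⟩ := h
  obtain ⟨z', rfl, rfl⟩ := h'
  exact ⟨z * z', by simp, by simp⟩

lemma neg (h : HasResidue y a) : HasResidue (-y) (-a) := by
  obtain ⟨z, rfl, rfl⟩ := h
  exact ⟨-z, by simp, by simp⟩

lemma pow (h : HasResidue y a) (n : ℕ) : HasResidue (y ^ n) (a ^ n) := by
  obtain ⟨z, rfl, rfl⟩ := h
  exact ⟨z ^ n, by simp, by simp⟩

lemma sum {ι : Type*} (s : Finset ι) {f : ι → K} {g : ι → ZMod p}
    (h : ∀ i ∈ s, HasResidue (f i) (g i)) : HasResidue (∑ i ∈ s, f i) (∑ i ∈ s, g i) := by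
  classical
  induction s using Finset.induction_on with
  | empty => simpa using zero
  | insert i s hi ih =>
    rw [Finset.sum_insert hi, Finset.sum_insert hi]
    exact (h i (Finset.mem_insert_self i s)).add
      (ih fun j hj => h j (Finset.mem_insert_of_mem hj))

lemma prod {ι : Type*} (s : Finset ι) {f : ι → K} {g : ι → ZMod p}
    (h : ∀ i ∈ s, HasResidue (f i) (g i)) : HasResidue (∏ i ∈ s, f i) (∏ i ∈ s, g i) := by
  classical
  induction s using Finset.induction_on with
  | empty => simpa using one
  | insert i s hi ih =>
    rw [Finset.prod_insert hi, Finset.prod_insert hi]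
    exact (h i (Finset.mem_insert_self i s)).mul
      (ih fun j hj => h j (Finset.mem_insert_of_mem hj))

lemma inv (h : HasResidue y a) (ha : a ≠ 0) : HasResidue y⁻¹ a⁻¹ := by
  obtain ⟨z, rfl, rfl⟩ := h
  have hz : IsUnit z := by
    by_contra hz
    have : z ∈ IsLocalRing.maximalIdeal ℤ_[p] := hz
    rw [← PadicInt.ker_toZMod, RingHom.mem_ker] at this
    exact ha this
  obtain ⟨u, rfl⟩ := hz
  refine ⟨(u⁻¹ : ℤ_[p]ˣ), eq_inv_of_mul_eq_one_left ?_, eq_inv_of_mul_eq_one_left ?_⟩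
  · rw [← map_mul, ← PadicInt.coe_mul, Units.inv_mul, PadicInt.coe_one, map_one]
  · rw [← map_mul, Units.inv_mul, map_one]

lemma div (h : HasResidue y a) (h' : HasResidue y' a') (ha' : a' ≠ 0) :
    HasResidue (y / y') (a / a') := by
  rw [div_eq_mul_inv, div_eq_mul_inv]
  exact h.mul (h'.inv ha')

end HasResidue

/-- A Jacobi sum of `A * χ` and `χ⁻¹` in terms of `A⁻¹` and `χ⁻¹`. -/
lemma sum_mul_apply_mul_inv_one_sub {F R : Type*} [Field F] [Fintype F] [DecidableEq F]
    [CommRing R] (A χ : MulChar F R) :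
    ∑ y : F, (A * χ) y * χ⁻¹ (1 - y) = ∑ u : Fˣ, A⁻¹ (u + 1) * χ⁻¹ u := by
  have key : ∀ f : F → R, f 0 = 0 → ∑ y : F, f y = ∑ u : Fˣ, f u := by
    intro f hf
    rw [← Fintype.sum_subtype_add_sum_subtype (fun y : F => y ≠ 0) f]
    have : ∑ i : {y : F // ¬ y ≠ 0}, f i = 0 :=
      Finset.sum_eq_zero fun i _ => by rw [not_not.mp i.2, hf]
    rw [this, add_zero]
    exact (Fintype.sum_equiv unitsEquivNeZero _ _ fun u => rfl).symm
  rw [key _ (by simp [MulChar.map_zero]), ← Equiv.sum_comp (Equiv.inv Fˣ)]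
  have h1 : ∀ u : Fˣ, (A * χ) ((Equiv.inv Fˣ u : Fˣ) : F) * χ⁻¹ (1 - (Equiv.inv Fˣ u : Fˣ)) =
      A⁻¹ u * χ⁻¹ (u - 1) := by
    intro u
    have h2 : ((u : F) - 1) = u * (1 - (u : F)⁻¹) := by
      rw [mul_sub, mul_inv_cancel₀ u.ne_zero, mul_one]
    rw [h2, map_mul, MulChar.coeToFun_mul, Pi.mul_apply, MulChar.inv_apply' A,
      MulChar.inv_apply' χ u]
    simp only [Equiv.inv_apply, Units.val_inv_eq_inv_val]
    ring
  rw [Finset.sum_congr rfl fun u _ => h1 u,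
    ← key (fun y => A⁻¹ y * χ⁻¹ (y - 1)) (by simp [MulChar.map_zero]),
    ← Equiv.sum_comp (Equiv.addRight (1 : F)), key _ (by simp [MulChar.map_zero])]
  simp

lemma prod_pow_mul_eq_prod_filter {G M : Type*} [CommGroup G] [Fintype G] [DecidableEq G]
    [CommMonoid M] {d t : ℕ} (ht : 0 < t) (g : G) (hg : orderOf g = d * t)
    (hgen : ∀ χ : G, χ ∈ Subgroup.zpowers g) (f : G → M) :
    ∏ m ∈ Finset.Ico 1 d, f (g ^ (m * t)) =
      ∏ χ ∈ Finset.univ.filter (fun χ : G => χ ^ d = 1 ∧ χ ≠ 1), f χ := by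
  refine Finset.prod_bij (fun m _ => g ^ (m * t)) ?_ ?_ ?_ fun _ _ => rfl
  · intro m hm
    rw [Finset.mem_Ico] at hm
    refine Finset.mem_filter.mpr ⟨Finset.mem_univ _, ?_, fun h => ?_⟩
    · rw [← pow_mul, show m * t * d = d * t * m by ring, pow_mul, ← hg, pow_orderOf_eq_one,
        one_pow]
    · rw [← orderOf_dvd_iff_pow_eq_one, hg] at h
      have := Nat.le_of_dvd (by omega) (Nat.dvd_of_mul_dvd_mul_right ht h)
      omega
  · intro m hm n hn h
    rw [Finset.mem_Ico] at hm hn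
    have h1 := pow_injOn_Iio_orderOf (G := G) (x₁ := m * t) (x₂ := n * t)
      (by rw [hg]; exact Nat.mul_lt_mul_of_pos_right hm.2 ht)
      (by rw [hg]; exact Nat.mul_lt_mul_of_pos_right hn.2 ht) h
    exact Nat.eq_of_mul_eq_mul_right ht h1
  · intro χ hχ
    obtain ⟨-, h1, h2⟩ := Finset.mem_filter.mp hχ
    obtain ⟨n, hn, rfl⟩ := (mem_zpowers_iff_mem_range_orderOf.mp (hgen χ) |> Finset.mem_image.mp)
    rw [← pow_mul, ← orderOf_dvd_iff_pow_eq_one, hg, mul_comm n d] at h1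
    rw [Finset.mem_range, hg] at hn
    have hd : 0 < d := Nat.pos_of_mul_pos_right (Nat.zero_lt_of_lt hn)
    obtain ⟨m, rfl⟩ := Nat.dvd_of_mul_dvd_mul_left hd h1
    refine ⟨m, Finset.mem_Ico.mpr ⟨?_, ?_⟩, by rw [mul_comm]⟩
    · by_contra hm
      have : m = 0 := by omega
      subst this
      exact h2 (by simp)
    · rw [mul_comm t m] at hn
      exact Nat.lt_of_mul_lt_mul_right hn

lemma sum_units_add_one_pow_mul_inv_pow {p : ℕ} [Fact p.Prime] {N k : ℕ} (hN : N < p - 1)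
    (hk : k < p - 1) :
    ∑ u : (ZMod p)ˣ, ((u : ZMod p) + 1) ^ N * ((u : ZMod p)⁻¹) ^ k = -(N.choose k : ZMod p) := by
  have h1 : ∀ u : (ZMod p)ˣ, ((u : ZMod p) + 1) ^ N * ((u : ZMod p)⁻¹) ^ k =
      ∑ j ∈ Finset.range (N + 1), (N.choose j : ZMod p) * (u : ZMod p) ^ (j + (p - 1 - k)) := by
    intro u
    have h2 : ((u : ZMod p)⁻¹) ^ k = (u : ZMod p) ^ (p - 1 - k) := by
      rw [inv_pow]
      refine inv_eq_of_mul_eq_one_right ?_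
      rw [← pow_add, show k + (p - 1 - k) = p - 1 by omega,
        ZMod.pow_card_sub_one_eq_one u.ne_zero]
    rw [h2, add_pow, Finset.sum_mul]
    refine Finset.sum_congr rfl fun j _ => ?_
    rw [pow_add]
    ring
  rw [Finset.sum_congr rfl fun u _ => h1 u, Finset.sum_comm]
  simp_rw [← Finset.mul_sum, FiniteField.sum_pow_units, ZMod.card]
  have h3 : ∀ j ∈ Finset.range (N + 1),
      (N.choose j : ZMod p) * (if p - 1 ∣ j + (p - 1 - k) then -1 else 0) =
        if j = k then -(N.choose k : ZMod p) else 0 := by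
    intro j hj
    rw [Finset.mem_range] at hj
    by_cases hjk : j = k
    · subst hjk
      rw [if_pos rfl, if_pos (by rw [show j + (p - 1 - j) = p - 1 by omega])]
      ring
    · rw [if_neg hjk, if_neg, mul_zero]
      rintro ⟨c, hc⟩
      have : c = 1 := by
        have h4 : 0 < c := Nat.pos_of_ne_zero (by rintro rfl; omega)
        have h5 : c < 2 := by
          by_contra h6
          have : (p - 1) * 2 ≤ (p - 1) * c := Nat.mul_le_mul_left _ (by omega)
          omega
        omega
      subst this
      omega
  rw [Finset.sum_congr rfl h3, Finset.sum_ite_eq' (Finset.range (N + 1)) k]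
  split_ifs with h
  · rfl
  · rw [Nat.choose_eq_zero_of_lt (by simpa using h)]
    simp

section TeichmullerPowers

variable {p : ℕ} [Fact p.Prime] {K : Type*} [NormedField K] [NormedAlgebra ℚ_[p] K]

/-- The Teichmüller character with values in a normed extension of `ℚ_p`. -/
noncomputable def teichmullerCharIn (p : ℕ) [Fact p.Prime] (K : Type*) [NormedField K]
    [NormedAlgebra ℚ_[p] K] : MulChar (ZMod p) K :=
  (teichmullerChar p).ringHomComp ((algebraMap ℚ_[p] K).comp PadicInt.Coe.ringHom)

lemma hasResidue_teichmullerCharIn (a : ZMod p) : HasResidue (teichmullerCharIn p K a) a :=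
  ⟨teichmullerChar p a, rfl, toZMod_teichmullerChar p a⟩

lemma hasResidue_teichmullerCharIn_pow (k : ℕ) (u : (ZMod p)ˣ) :
    HasResidue ((teichmullerCharIn p K ^ k) u) ((u : ZMod p) ^ k) := by
  rw [MulChar.pow_apply_coe]
  exact (hasResidue_teichmullerCharIn _).pow k

lemma orderOf_teichmullerCharIn : orderOf (teichmullerCharIn p K) = p - 1 := by
  refine Nat.dvd_antisymm ?_ ?_
  · have h := (teichmullerCharIn p K).pow_card_eq_one
    rw [ZMod.card_units] at h
    exact orderOf_dvd_of_pow_eq_one h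
  · obtain ⟨g, hg⟩ := IsCyclic.exists_generator (α := (ZMod p)ˣ)
    have hord := orderOf_eq_card_of_forall_mem_zpowers hg
    rw [Nat.card_eq_fintype_card, ZMod.card_units] at hord
    rw [← hord]
    apply orderOf_dvd_of_pow_eq_one
    obtain ⟨z, hz, hza⟩ := hasResidue_teichmullerCharIn_pow (K := K)
      (orderOf (teichmullerCharIn p K)) g
    rw [pow_orderOf_eq_one, MulChar.one_apply_coe, ← map_one (algebraMap ℚ_[p] K)] at hz
    have hz1 : z = 1 := by
      have := (algebraMap ℚ_[p] K).injective hz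
      exact Subtype.ext this
    rw [hz1, map_one] at hza
    ext
    rw [Units.val_pow_eq_pow_val, ← hza, Units.val_one]

lemma hasResidue_card_mul_jacB {N k : ℕ} (hN0 : N ≠ 0) (hN : N < p - 1) (hk : k < p - 1) :
    HasResidue ((p : K) * jacB ((teichmullerCharIn p K)⁻¹ ^ N * teichmullerCharIn p K ^ k)
        (teichmullerCharIn p K ^ k))
      ((-1) ^ k * -(N.choose k : ZMod p)) := by
  set ω := teichmullerCharIn p K
  have hp : (p : K) ≠ 0 := by
    rw [← map_natCast (algebraMap ℚ_[p] K), map_ne_zero]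
    exact_mod_cast (Fact.out : p.Prime).ne_zero
  have h1 : (p : K) * jacB (ω⁻¹ ^ N * ω ^ k) (ω ^ k) =
      (ω ^ k) ((-1 : (ZMod p)ˣ) : ZMod p) *
        ∑ u : (ZMod p)ˣ, (ω ^ N) (u + 1) * (ω ^ k) ((u⁻¹ : (ZMod p)ˣ) : ZMod p) := by
    rw [jacB, ZMod.card, sum_mul_apply_mul_inv_one_sub, ← mul_assoc, mul_div_cancel₀ _ hp]
    simp only [inv_pow, inv_inv, MulChar.inv_apply', Units.val_neg, Units.val_one,
      Units.val_inv_eq_inv_val]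
  rw [h1, ← sum_units_add_one_pow_mul_inv_pow hN hk]
  refine HasResidue.mul ?_ (HasResidue.sum _ fun u _ => HasResidue.mul ?_ ?_)
  · simpa only [Units.val_neg, Units.val_one] using
      hasResidue_teichmullerCharIn_pow (K := K) k (-1 : (ZMod p)ˣ)
  · rw [MulChar.pow_apply' _ hN0]
    exact (hasResidue_teichmullerCharIn _).pow N
  · simpa only [Units.val_inv_eq_inv_val] using
      hasResidue_teichmullerCharIn_pow (K := K) k u⁻¹

lemma hasResidue_risingFac_div_factorial {d t : ℕ} (hdt : d * t = p - 1) (m : ℕ) {k : ℕ}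
    (hk : k < p) :
    HasResidue ((risingFac ((m : ℚ) / d) k / (k.factorial : ℚ) : ℚ) : K)
      ((-1) ^ k * ((m * t).choose k : ZMod p)) := by
  have hp := (Fact.out : p.Prime)
  have : CharZero K := charZero_of_injective_algebraMap (algebraMap ℚ_[p] K).injective
  have hdt' : (d : ZMod p) * t = -1 := by
    rw [← Nat.cast_mul, hdt, Nat.cast_sub hp.one_le, CharP.cast_eq_zero, Nat.cast_one, zero_sub]
  have hd0 : (d : ZMod p) ≠ 0 := by
    intro h
    rw [h, zero_mul] at hdt'
    exact one_ne_zero (neg_eq_zero.mp hdt'.symm)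
  have hk0 : (k.factorial : ZMod p) ≠ 0 := by
    rw [Ne, ZMod.natCast_eq_zero_iff, hp.dvd_factorial]
    omega
  have hfac : (-1 : ZMod p) ^ k * ((m * t).choose k : ZMod p) =
      (∏ i ∈ Finset.range k, ((m : ZMod p) / d + i)) / (k.factorial : ZMod p) := by
    rw [eq_div_iff hk0, mul_assoc, mul_comm ((m * t).choose k : ZMod p), ← Nat.cast_mul,
      ← Nat.descFactorial_eq_factorial_mul_choose, ← descPochhammer_eval_eq_descFactorial,
      descPochhammer_eval_eq_prod_range, ← Finset.card_range k, ← Finset.prod_const,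
      Finset.card_range, ← Finset.prod_mul_distrib]
    refine Finset.prod_congr rfl fun i _ => ?_
    have hinv : (d : ZMod p)⁻¹ = -t :=
      inv_eq_of_mul_eq_one_right (by rw [mul_neg, hdt', neg_neg])
    rw [div_eq_mul_inv, hinv]
    push_cast
    ring
  rw [hfac]
  simp only [risingFac, Rat.cast_div, Rat.cast_prod, Rat.cast_add, Rat.cast_natCast]
  refine HasResidue.div (HasResidue.prod _ fun i _ => HasResidue.add ?_ (HasResidue.natCast i))
    (HasResidue.natCast _) hk0
  exact HasResidue.div (HasResidue.natCast m) (HasResidue.natCast d) hd0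

end TeichmullerPowers

/-- Absorbing the factor `qⁿ` into unnormalized Jacobi sums when all lower
parameters are trivial. -/
lemma card_pow_mul_greeneF_one {F K : Type*} [Field F] [Fintype F] [Field K] (n : ℕ)
    (A : Fin (n + 1) → MulChar F K) (x : F) :
    (Fintype.card F : K) ^ n * greeneF n A (fun _ => 1) x =
      ((Fintype.card F : K) - 1)⁻¹ * ∑ᶠ χ : MulChar F K,
        (∏ i, ((Fintype.card F : K) * jacB (A i * χ) χ)) * χ x := by
  rw [greeneF, div_eq_mul_inv, mul_assoc, ← mul_assoc _ (Fintype.card F : K), ← pow_succ,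
    mul_left_comm, mul_finsum]
  simp only [one_mul, Finset.prod_mul_distrib, Finset.prod_const, Finset.card_univ,
    Fintype.card_fin, mul_assoc, Fin.prod_univ_succ (n := n) (fun i => jacB (A i * _) _)]

/-- Theorem 3.3: for `d ≥ 2`, `p ≡ 1 (mod d)` prime, `t = (p-1)/d`, and `T` a generator of the
group of multiplicative characters of `F_p^×` with values in `ℂ_p` (formalized as an
algebraically closed complete nontrivially normed field extension `K` of `ℚ_p`): for every
`x ∈ F_p^×` with integer lift `x̂`,
`p^{d-2} · ₍d-1₎F₍d-2₎(T^t, …, T^{(d-1)t}; ε, …, ε | x)ₚ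
  ≡ (-1)^d · ₍d-1₎F₍d-2₎(1/d, …, (d-1)/d; 1, …, 1 | x̂)_{tr(p)} (mod p)`,
the congruence holding in the valuation ring (difference of norm at most `1/p`). -/
theorem classical_dFd_congruent_greene_dFd
    (d : ℕ) (hd : 2 ≤ d) (p : ℕ) [Fact p.Prime] (hpd : p % d = 1)
    (K : Type*) [NontriviallyNormedField K] [IsAlgClosed K]
    [NormedAlgebra ℚ_[p] K] [CompleteSpace K]
    (t : ℕ) (ht : t = (p - 1) / d)
    (T : MulChar (ZMod p) K) (hT : ∀ χ : MulChar (ZMod p) K, χ ∈ Subgroup.zpowers T)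
    (x : ZMod p) (hx : x ≠ 0) (xh : ℤ) (hxh : (xh : ZMod p) = x) :
    ‖(p : K) ^ (d - 2) *
        greeneF (d - 2) (fun i : Fin (d - 2 + 1) => T ^ (((i : ℕ) + 1) * t))
          (fun _ => 1) x -
      (((-1 : ℚ) ^ d *
          ∑ k ∈ Finset.range p,
            (∏ m ∈ Finset.Ico 1 d, risingFac ((m : ℚ) / d) k) /
              (risingFac 1 k ^ (d - 2) * (k.factorial : ℚ)) * (xh : ℚ) ^ k : ℚ) : K)‖
      ≤ (p : ℝ)⁻¹ := by

  have hp : p.Prime := Fact.out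
  have : CharZero K := charZero_of_injective_algebraMap (algebraMap ℚ_[p] K).injective
  have hdt : d * t = p - 1 := by
    rw [ht, Nat.mul_div_cancel' ((Nat.modEq_iff_dvd' hp.one_le).mp ?_)]
    rw [Nat.ModEq, hpd, Nat.mod_eq_of_lt (by omega)]
  have hp1 : 0 < p - 1 := Nat.sub_pos_of_lt hp.one_lt
  have ht0 : 0 < t := Nat.pos_of_mul_pos_left (hdt ▸ hp1)
  have htp : t < p - 1 := by nlinarith
  set ω : MulChar (ZMod p) K := teichmullerCharIn p K
  have hωord : orderOf ω = p - 1 := orderOf_teichmullerCharIn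
  have hTcard : Nat.card (MulChar (ZMod p) K) = orderOf T :=
    (orderOf_eq_card_of_forall_mem_zpowers hT).symm
  have hTdvd : orderOf T ∣ p - 1 := by
    have h := T.pow_card_eq_one
    rw [ZMod.card_units] at h
    exact orderOf_dvd_of_pow_eq_one h
  have hωdvd : p - 1 ∣ orderOf T := by
    rw [← hωord, ← hTcard]
    exact orderOf_dvd_natCard ω
  have hTord : orderOf T = p - 1 := Nat.dvd_antisymm hTdvd hωdvd
  have hωgen : ∀ χ : MulChar (ZMod p) K, χ ∈ Subgroup.zpowers ω := by
    have h : Subgroup.zpowers ω = ⊤ := by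
      apply Subgroup.eq_top_of_card_eq
      rw [Nat.card_zpowers, hωord, hTcard, hTord]
    simp [h]
  classical
  have : Fintype (MulChar (ZMod p) K) := Fintype.ofFinite _
  have hperm : ∀ f : MulChar (ZMod p) K → K,
      ∏ i : Fin (d - 2 + 1), f (T ^ (((i : ℕ) + 1) * t)) =
        ∏ m ∈ Finset.Ico 1 d, f (ω⁻¹ ^ (m * t)) := by
    intro f
    rw [prod_pow_mul_eq_prod_filter ht0 ω⁻¹ (by rw [orderOf_inv, hωord, hdt])
        (fun χ => by rw [Subgroup.zpowers_inv]; exact hωgen χ) f,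
      ← prod_pow_mul_eq_prod_filter ht0 T (by rw [hTord, hdt]) hT f,
      Finset.prod_Ico_eq_prod_range, Finset.prod_range (n := d - 1)]
    refine Fintype.prod_equiv (finCongr (by omega)) _ _ fun i => ?_
    simp [add_comm]
  have hsum : ∀ f : MulChar (ZMod p) K → K,
      ∑ᶠ χ, f χ = ∑ k ∈ Finset.range (p - 1), f (ω ^ k) := by
    intro f
    rw [finsum_eq_sum_of_fintype]
    symm
    refine Finset.sum_bij (fun k _ => ω ^ k) (fun _ _ => Finset.mem_univ _) ?_ ?_ fun _ _ => rfl
    · intro a ha b hb h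
      rw [Finset.mem_range, ← hωord] at ha hb
      exact pow_injOn_Iio_orderOf ha hb h
    · intro χ _
      obtain ⟨n, hn, rfl⟩ := Finset.mem_image.mp (mem_zpowers_iff_mem_range_orderOf.mp (hωgen χ))
      exact ⟨n, by rwa [← hωord], rfl⟩
  have hmt : ∀ m ∈ Finset.Ico 1 d, m * t ≠ 0 ∧ m * t < p - 1 := by
    intro m hm
    rw [Finset.mem_Ico] at hm
    exact ⟨(Nat.mul_pos hm.1 ht0).ne', hdt ▸ Nat.mul_lt_mul_of_pos_right hm.2 ht0⟩
  have hcardF : (Fintype.card (ZMod p) : K) = p := by rw [ZMod.card]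
  have hleft : HasResidue ((p : K) ^ (d - 2) *
        greeneF (d - 2) (fun i : Fin (d - 2 + 1) => T ^ (((i : ℕ) + 1) * t)) (fun _ => 1) x)
      ((((p : ℕ) : ZMod p) - 1)⁻¹ * ∑ k ∈ Finset.range (p - 1),
        (∏ m ∈ Finset.Ico 1 d, ((-1) ^ k * -((m * t).choose k : ZMod p))) * x ^ k) := by
    rw [← hcardF, card_pow_mul_greeneF_one, hsum, hcardF]
    refine HasResidue.mul (HasResidue.inv ((HasResidue.natCast p).sub .one) (by simp))
      (HasResidue.sum _ fun k hk => HasResidue.mul ?_ ?_)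
    · rw [hperm fun χ => (p : K) * jacB (χ * ω ^ k) (ω ^ k)]
      exact HasResidue.prod _ fun m hm =>
        hasResidue_card_mul_jacB (hmt m hm).1 (hmt m hm).2 (Finset.mem_range.mp hk)
    · exact hasResidue_teichmullerCharIn_pow k (Units.mk0 x hx)
  have hright : HasResidue ((((-1 : ℚ) ^ d *
          ∑ k ∈ Finset.range p,
            (∏ m ∈ Finset.Ico 1 d, risingFac ((m : ℚ) / d) k) /
              (risingFac 1 k ^ (d - 2) * (k.factorial : ℚ)) * (xh : ℚ) ^ k : ℚ) : K))
      ((-1) ^ d * ∑ k ∈ Finset.range p,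
        (∏ m ∈ Finset.Ico 1 d, ((-1) ^ k * ((m * t).choose k : ZMod p))) * x ^ k) := by
    have hterm : ∀ k : ℕ, (∏ m ∈ Finset.Ico 1 d, risingFac ((m : ℚ) / d) k) /
        (risingFac 1 k ^ (d - 2) * (k.factorial : ℚ)) =
          ∏ m ∈ Finset.Ico 1 d, (risingFac ((m : ℚ) / d) k / (k.factorial : ℚ)) := by
      intro k
      have hfac : risingFac 1 k = k.factorial := by
        rw [risingFac, ← Finset.prod_range_add_one_eq_factorial]
        push_cast
        exact Finset.prod_congr rfl fun i _ => add_comm _ _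
      rw [hfac, ← pow_succ, Finset.prod_div_distrib, Finset.prod_const, Nat.card_Ico,
        show d - 2 + 1 = d - 1 by omega]
    simp only [hterm, Rat.cast_mul, Rat.cast_pow, Rat.cast_neg, Rat.cast_one, Rat.cast_sum,
      Rat.cast_prod, Rat.cast_intCast]
    refine HasResidue.mul (HasResidue.one.neg.pow d) (HasResidue.sum _ fun k hk =>
      HasResidue.mul (HasResidue.prod _ fun m _ => ?_) (hxh ▸ (HasResidue.intCast xh).pow k))
    exact hasResidue_risingFac_div_factorial hdt m (Finset.mem_range.mp hk)
  refine hleft.norm_sub_le ?_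
  convert hright using 1
  have hlast : ∏ m ∈ Finset.Ico 1 d, ((-1) ^ (p - 1) * ((m * t).choose (p - 1) : ZMod p)) = 0 := by
    refine Finset.prod_eq_zero (i := 1) (Finset.mem_Ico.mpr ⟨le_rfl, by omega⟩) ?_
    rw [one_mul, Nat.choose_eq_zero_of_lt htp, Nat.cast_zero, mul_zero]
  have hrange : Finset.range p = Finset.range (p - 1 + 1) := by
    rw [Nat.sub_add_cancel hp.one_le]
  rw [hrange, Finset.sum_range_succ, hlast, zero_mul, add_zero, CharP.cast_eq_zero, zero_sub]
  simp only [mul_neg, Finset.prod_neg, Nat.card_Ico, mul_assoc, ← Finset.mul_sum]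
  rw [← mul_assoc]
  congr 1
  obtain ⟨e, rfl⟩ := Nat.exists_eq_add_of_le hd
  rw [show 2 + e - 1 = e + 1 by omega, pow_add _ 2 e, pow_succ]
  norm_num
end

section
/- Let p ≡ 1 (mod 4) be prime, set t = (p−1)/4, and let T be a generator of the group of multiplicative characters of F_p^× with values in ℂ_p. Then for every x ∈ F_p^× and every integer lift x̂ of x, ₃F₂(1/4, 2/4, 3/4; 1, 1 | x̂)_{tr(p)} ≡ p² · ₃F₂(T^t, T^{2t}, T^{3t}; ε, ε | x)_p (mod p), the congruence holding in the valuation ring of ℂ_p. -/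
/-- Greene's finite field hypergeometric function `₃F₂(A₀, A₁, A₂; B₁, B₂ | x)`. -/
noncomputable def greene3F2 {F K : Type*} [Field F] [Fintype F] [Field K]
    (A₀ A₁ A₂ B₁ B₂ : MulChar F K) (x : F) : K :=
  (Fintype.card F : K) / ((Fintype.card F : K) - 1) *
    ∑ᶠ χ : MulChar F K,
      jacB (A₀ * χ) χ * jacB (A₁ * χ) (B₁ * χ) * jacB (A₂ * χ) (B₂ * χ) * χ x

open Finset

/-- The Teichmüller character. -/
theorem exists_mulChar_padicInt_lift (p : ℕ) [Fact p.Prime] :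
    ∃ ω : MulChar (ZMod p) ℤ_[p], ∀ u, PadicInt.toZMod (ω u) = u := by
  let e : ℤ_[p] ≃+* WittVector p (ZMod p) := (WittVector.equiv p).symm
  have hred : (WittVector.constantCoeff : WittVector p (ZMod p) →+* ZMod p).comp
      (e : ℤ_[p] →+* _) = PadicInt.toZMod := by
    apply ZMod.ringHom_eq_of_ker_eq
    rw [PadicInt.ker_toZMod]
    exact IsLocalRing.eq_maximalIdeal
      (RingHom.ker_isMaximal_of_surjective _ (ZMod.ringHom_surjective _))
  refine ⟨{ toMonoidHom := (e.symm : WittVector p (ZMod p) →* ℤ_[p]).comp (WittVector.teichmuller p)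
            map_nonunit' := ?_ }, fun u ↦ ?_⟩
  · intro a ha
    have : a = 0 := by simpa using ha
    subst this
    simp
  · rw [← hred]
    simp [WittVector.constantCoeff]

theorem ZMod.sum_pow_eq_ite (p : ℕ) [Fact p.Prime] {N : ℕ} (h0 : 0 < N) (h : N < 2 * (p - 1)) :
    ∑ x : ZMod p, x ^ N = if N = p - 1 then -1 else 0 := by
  classical
  have h1 := FiniteField.sum_pow_units (ZMod p) N
  rw [ZMod.card] at h1
  have h2 : ∑ x : ZMod p, x ^ N = ∑ x : (ZMod p)ˣ, (x : ZMod p) ^ N := by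
    rw [← Finset.sum_subset (Finset.subset_univ (Finset.univ.filter (fun x : ZMod p ↦ x ≠ 0)))]
    · symm
      refine Finset.sum_bij (fun x _ ↦ (x : ZMod p)) (by simp) (by intros; ext; assumption) ?_
        (by simp)
      intro b hb
      exact ⟨Units.mk0 b (by simpa using hb), by simp⟩
    · intro x _ hx
      have : x = 0 := by simpa using hx
      simp [this, h0.ne']
  rw [h2]
  rw [h1]
  congr 1
  apply propext
  constructor
  · rintro ⟨c, rfl⟩
    have : c < 2 := by
      by_contra hc
      have := Nat.mul_le_mul_left (p - 1) (not_lt.mp hc)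
      omega
    interval_cases c <;> simp_all
  · rintro rfl; rfl

theorem ZMod.choose_sub_one_sub (p : ℕ) [Fact p.Prime] {j s : ℕ} (hjs : j ≤ s) (hs : s < p) :
    (((p - 1 - j).choose (s - j) : ℕ) : ZMod p) = (-1) ^ (s - j) * (s.choose j : ℕ) := by
  obtain ⟨d, rfl⟩ := Nat.exists_eq_add_of_le hjs
  rw [Nat.add_sub_cancel_left]
  induction d with
  | zero => simp
  | succ d ih =>
    have ih := ih (by omega) (by omega)
    have h1 := Nat.choose_succ_right_eq (p - 1 - j) d
    have h2 := Nat.choose_mul_succ_eq (j + d) j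
    have h3 : j + d + 1 - j = d + 1 := by omega
    rw [h3] at h2
    have hd : ((d + 1 : ℕ) : ZMod p) ≠ 0 := by
      rw [Ne, ZMod.natCast_eq_zero_iff]
      exact Nat.not_dvd_of_pos_of_lt (by omega) (by omega)
    apply mul_right_cancel₀ hd
    have e : p - 1 - j - d + (j + d + 1) = p := by omega
    have e' : ((p - 1 - j - d : ℕ) : ZMod p) = -((j + d + 1 : ℕ) : ZMod p) := by
      have := congrArg (Nat.cast (R := ZMod p)) e
      rw [Nat.cast_add, ZMod.natCast_self] at this
      linear_combination this
    rw [mul_assoc, ← add_assoc, ← Nat.cast_mul, ← Nat.cast_mul, h1, ← h2, Nat.cast_mul, Nat.cast_mul,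
      ih, e']
    ring

theorem ZMod.sum_pow_mul_one_sub_pow (p : ℕ) [Fact p.Prime] {s j : ℕ} (hs0 : 0 < s) (hs : s < p - 1)
    (hj : j < p - 1) :
    ∑ x : ZMod p, x ^ (p - 1 - s + j) * (1 - x) ^ (p - 1 - j) = -(s.choose j : ℕ) := by
  have h1 : ∀ x : ZMod p, x ^ (p - 1 - s + j) * (1 - x) ^ (p - 1 - j) =
      ∑ k ∈ range (p - 1 - j + 1),
        ((-1) ^ k * ((p - 1 - j).choose k : ℕ)) * x ^ (p - 1 - s + j + k) := by
    intro x
    rw [sub_eq_neg_add, add_pow, Finset.mul_sum]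
    refine Finset.sum_congr rfl fun k _ ↦ ?_
    rw [neg_pow, pow_add x]
    ring
  simp_rw [h1]
  rw [Finset.sum_comm]
  simp_rw [← Finset.mul_sum]
  have h2 : ∀ k ∈ range (p - 1 - j + 1),
      ((-1) ^ k * ((p - 1 - j).choose k : ℕ)) * ∑ x : ZMod p, x ^ (p - 1 - s + j + k) =
      if k + j = s then -((-1) ^ k * ((p - 1 - j).choose k : ℕ) : ZMod p) else 0 := by
    intro k hk
    rw [mem_range] at hk
    rw [ZMod.sum_pow_eq_ite p (by omega) (by omega)]
    by_cases h : k + j = s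
    · rw [if_pos h, if_pos (by omega)]; ring
    · rw [if_neg h, if_neg (by omega)]; ring
  rw [Finset.sum_congr rfl h2]
  by_cases hjs : j ≤ s
  · rw [Finset.sum_eq_single_of_mem (s - j) (mem_range.mpr (by omega))
      (fun k _ hk ↦ if_neg (by omega)), if_pos (by omega), ZMod.choose_sub_one_sub p hjs (by omega),
      ← mul_assoc, ← mul_pow]
    simp
  · rw [Finset.sum_eq_zero fun k _ ↦ if_neg (by omega), Nat.choose_eq_zero_of_lt (by omega)]
    simp

theorem prod_range_neg_natCast_add {R : Type*} [CommRing R] (s k : ℕ) :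
    ∏ i ∈ range k, (-(s : R) + i) = (-1) ^ k * (s.descFactorial k : ℕ) := by
  induction k with
  | zero => simp
  | succ k ih =>
    rw [Finset.prod_range_succ, ih, Nat.descFactorial_succ]
    rcases le_or_gt k s with h | h
    · push_cast [Nat.cast_sub h]
      ring
    · simp [Nat.descFactorial_eq_zero_iff_lt.mpr h]

/-- Modulo `p`, if `n / d ≡ -s` then `(n / d)ₖ / k! ≡ (-1)ᵏ * choose s k`. -/
theorem exists_padicInt_risingFac_div_factorial {p : ℕ} [Fact p.Prime] {K : Type*} [Field K]
    [CharZero K] (φ : ℤ_[p] →+* K) {s d n k : ℕ} (hd : d ≠ 0)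
    (hdp : d < p) (hsd : ((d * s + n : ℕ) : ZMod p) = 0) (hk : k < p) :
    ∃ z : ℤ_[p], φ z = ((risingFac (n / d) k / k.factorial : ℚ) : K) ∧
      PadicInt.toZMod z = (-1) ^ k * (s.choose k : ℕ) := by
  have unit : ∀ m : ℕ, p.Coprime m → ∃ w : ℤ_[p], (m : ℤ_[p]) * w = 1 := fun m hm ↦
    (PadicInt.isUnit_iff.mpr (PadicInt.norm_natCast_eq_one_iff.mpr hm)).exists_right_inv
  obtain ⟨w, hw⟩ := unit d (Nat.coprime_of_lt_prime hd hdp Fact.out)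
  obtain ⟨v, hv⟩ := unit k.factorial
    ((Nat.Prime.coprime_iff_not_dvd Fact.out).mpr
      fun h ↦ hk.not_ge ((Nat.Prime.dvd_factorial Fact.out).mp h))
  refine ⟨(∏ i ∈ range k, (n * w + i)) * v, ?_, ?_⟩
  · have hw' : φ w = (d : K)⁻¹ :=
      eq_inv_of_mul_eq_one_right (by simpa using congrArg φ hw)
    have hv' : φ v = (k.factorial : K)⁻¹ :=
      eq_inv_of_mul_eq_one_right (by simpa using congrArg φ hv)
    simp only [map_mul, map_prod, map_add, map_natCast, hw', hv', risingFac]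
    push_cast
    simp only [div_eq_mul_inv]
  · have hw' := congrArg (PadicInt.toZMod (p := p)) hw
    have hv' := congrArg (PadicInt.toZMod (p := p)) hv
    simp only [map_mul, map_natCast, map_one] at hw' hv'
    have hn : (n : ZMod p) * PadicInt.toZMod w = -(s : ZMod p) := by
      push_cast at hsd
      linear_combination PadicInt.toZMod w * hsd - (s : ZMod p) * hw'
    simp only [map_mul, map_prod, map_add, map_natCast, hn]
    rw [prod_range_neg_natCast_add, Nat.descFactorial_eq_factorial_mul_choose, Nat.cast_mul]
    linear_combination (-1) ^ k * (s.choose k : ZMod p) * hv'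

/-- A `p`-adic integer that reduces to zero has norm at most `1/p`. -/
theorem PadicInt.norm_le_inv_of_toZMod_eq_zero {p : ℕ} [Fact p.Prime] {z : ℤ_[p]}
    (hz : PadicInt.toZMod z = 0) : ‖z‖ ≤ (p : ℝ)⁻¹ := by
  rw [← RingHom.mem_ker, PadicInt.ker_toZMod, PadicInt.maximalIdeal_eq_span_p] at hz
  have := (PadicInt.norm_le_pow_iff_mem_span_pow z 1).mpr (by simpa using hz)
  simpa using this

theorem orderOf_eq_of_toZMod_apply {p : ℕ} [Fact p.Prime] {ω : MulChar (ZMod p) ℤ_[p]}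
    (hω : ∀ u, PadicInt.toZMod (ω u) = u) : orderOf ω = p - 1 := by
  refine Nat.dvd_antisymm (orderOf_dvd_of_pow_eq_one ?_) ?_
  · ext u
    rw [MulChar.pow_apply_coe, ← map_pow, ← Units.val_pow_eq_pow_val,
      ZMod.units_pow_card_sub_one_eq_one]
    simp
  · obtain ⟨g, hg⟩ := IsCyclic.exists_generator (α := (ZMod p)ˣ)
    rw [← ZMod.card_units p, ← Nat.card_eq_fintype_card,
      ← orderOf_eq_card_of_forall_mem_zpowers hg]
    apply orderOf_dvd_of_pow_eq_one
    ext
    have := congrArg (fun χ : MulChar (ZMod p) ℤ_[p] ↦ PadicInt.toZMod (χ g))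
      (pow_orderOf_eq_one ω)
    simpa only [MulChar.pow_apply_coe, map_pow, hω, MulChar.one_apply_coe, map_one,
      Units.val_pow_eq_pow_val, Units.val_one] using this

/-- The reduction modulo `p` of the Jacobi sums of powers of the Teichmüller character. -/
theorem exists_padicInt_jacB {p : ℕ} [Fact p.Prime] {K : Type*} [Field K] (φ : ℤ_[p] →+* K)
    {ω : MulChar (ZMod p) ℤ_[p]} (hω : ∀ u, PadicInt.toZMod (ω u) = u) {s j : ℕ} (hs0 : 0 < s)
    (hs : s < p - 1) (hj : j < p - 1) :
    ∃ u : ℤ_[p], PadicInt.toZMod u = -((-1) ^ j * (s.choose j : ℕ)) ∧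
      jacB (ω.ringHomComp φ ^ (p - 1 - s) * ω.ringHomComp φ ^ j) (ω.ringHomComp φ ^ j) =
        φ u / p := by
  have hinv : (ω ^ j)⁻¹ = ω ^ (p - 1 - j) := by
    rw [inv_eq_iff_mul_eq_one, ← pow_add, Nat.add_sub_cancel' hj.le,
      ← orderOf_eq_of_toZMod_apply hω, pow_orderOf_eq_one]
  have hpow : ∀ (n : ℕ) (y : ZMod p), 0 < n → PadicInt.toZMod ((ω ^ n) y) = y ^ n := by
    intro n y hn
    rw [MulChar.pow_apply' _ hn.ne', map_pow, hω]
  refine ⟨(ω ^ j) (-1) * ∑ y, (ω ^ (p - 1 - s + j)) y * (ω ^ (p - 1 - j)) (1 - y), ?_, ?_⟩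
  · rw [map_mul, map_sum]
    have : ∀ y : ZMod p, PadicInt.toZMod ((ω ^ (p - 1 - s + j)) y * (ω ^ (p - 1 - j)) (1 - y)) =
        y ^ (p - 1 - s + j) * (1 - y) ^ (p - 1 - j) := by
      intro y
      rw [map_mul, hpow _ _ (by omega), hpow _ _ (by omega)]
    simp_rw [this]
    rw [ZMod.sum_pow_mul_one_sub_pow p hs0 hs hj]
    have h1 : PadicInt.toZMod ((ω ^ j) (-1)) = (-1) ^ j := by
      have := MulChar.pow_apply_coe ω j (-1)
      rw [Units.val_neg, Units.val_one] at this
      rw [this, map_pow, hω]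
    rw [h1]
    ring
  · rw [jacB, MulChar.ringHomComp_pow, MulChar.ringHomComp_pow, ← MulChar.ringHomComp_mul,
      MulChar.ringHomComp_inv, hinv, ← pow_add, ZMod.card]
    simp only [MulChar.ringHomComp_apply, map_mul, map_sum]
    ring

theorem orderOf_ringHomComp {R R' R'' : Type*} [CommRing R] [CommRing R'] [CommRing R'']
    {f : R' →+* R''} (hf : Function.Injective f) (χ : MulChar R R') :
    orderOf (χ.ringHomComp f) = orderOf χ := by
  refine Nat.dvd_antisymm (orderOf_dvd_of_pow_eq_one ?_) (orderOf_dvd_of_pow_eq_one ?_)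
  · rw [MulChar.ringHomComp_pow, pow_orderOf_eq_one, MulChar.ringHomComp_one]
  · rw [← MulChar.ringHomComp_eq_one_iff hf, ← MulChar.ringHomComp_pow, pow_orderOf_eq_one]

theorem greene3F2_one_one_reverse {F K : Type*} [Field F] [Fintype F] [Field K]
    (A B C : MulChar F K) (x : F) : greene3F2 A B C 1 1 x = greene3F2 C B A 1 1 x := by
  rw [greene3F2, greene3F2]
  congr 1
  refine finsum_congr fun χ ↦ ?_
  rw [one_mul]
  ring

/-- The reduction modulo `p` of `p² * (p - 1) * ₃F₂` at powers of the Teichmüller character. -/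
theorem exists_padicInt_greene3F2 {p : ℕ} [Fact p.Prime] {K : Type*} [Field K] [CharZero K]
    (φ : ℤ_[p] →+* K) {ω : MulChar (ZMod p) ℤ_[p]} (hω : ∀ u, PadicInt.toZMod (ω u) = u)
    (hgen : ∀ χ : MulChar (ZMod p) K, χ ∈ Subgroup.zpowers (ω.ringHomComp φ))
    (hord : orderOf (ω.ringHomComp φ) = p - 1) {s₀ s₁ s₂ : ℕ}
    (h₀ : 0 < s₀) (h₁ : 0 < s₁) (h₂ : 0 < s₂) (h₀' : s₀ < p - 1) (h₁' : s₁ < p - 1)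
    (h₂' : s₂ < p - 1) {x : ZMod p} (hx : x ≠ 0) :
    ∃ S : ℤ_[p],
      PadicInt.toZMod S = -∑ j ∈ range (p - 1), ((-1) ^ j * (s₀.choose j : ℕ)) *
        ((-1) ^ j * (s₁.choose j : ℕ)) * ((-1) ^ j * (s₂.choose j : ℕ)) * x ^ j ∧
      (p - 1 : K) * ((p : K) ^ 2 * greene3F2 (ω.ringHomComp φ ^ (p - 1 - s₀))
        (ω.ringHomComp φ ^ (p - 1 - s₁)) (ω.ringHomComp φ ^ (p - 1 - s₂)) 1 1 x) = φ S := by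
  classical
  have := Fintype.ofFinite (MulChar (ZMod p) K)
  have hp : (p : K) ≠ 0 := Nat.cast_ne_zero.mpr (Fact.out : p.Prime).ne_zero
  have hp1 : (p - 1 : K) ≠ 0 := sub_ne_zero.mpr (by exact_mod_cast (Fact.out : p.Prime).ne_one)
  choose! u₀ hu₀ hJ₀ using fun j ↦ exists_padicInt_jacB φ hω (j := j) h₀ h₀'
  choose! u₁ hu₁ hJ₁ using fun j ↦ exists_padicInt_jacB φ hω (j := j) h₁ h₁'
  choose! u₂ hu₂ hJ₂ using fun j ↦ exists_padicInt_jacB φ hω (j := j) h₂ h₂'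
  refine ⟨∑ j ∈ range (p - 1), u₀ j * u₁ j * u₂ j * ω x ^ j, ?_, ?_⟩
  · rw [map_sum, ← Finset.sum_neg_distrib]
    refine Finset.sum_congr rfl fun j hj ↦ ?_
    rw [mem_range] at hj
    simp only [map_mul, map_pow, hω, hu₀ j hj, hu₁ j hj, hu₂ j hj]
    ring
  · rw [greene3F2, finsum_eq_sum_of_fintype, ← IsCyclic.image_range_orderOf hgen,
      Finset.sum_image (fun a ha b hb h ↦ pow_injOn_Iio_orderOf
        (by simpa using ha) (by simpa using hb) h), hord, map_sum, ZMod.card, Finset.mul_sum,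
      Finset.mul_sum, Finset.mul_sum]
    refine Finset.sum_congr rfl fun j hj ↦ ?_
    rw [mem_range] at hj
    have hxj : (ω.ringHomComp φ ^ j) x = φ (ω x) ^ j := by
      simpa using MulChar.pow_apply_coe (ω.ringHomComp φ) j (Units.mk0 x hx)
    rw [one_mul, hJ₀ j hj, hJ₁ j hj, hJ₂ j hj, hxj]
    simp only [map_mul, map_pow]
    field_simp

/-- A generator of the character group and the Teichmüller character give the same unordered triple
of nontrivial characters of order dividing four. -/
theorem pow_mem_quarter_powers {G : Type*} [Group G] {T ω : G} {t : ℕ} (ht : 0 < t)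
    (hT : orderOf T = 4 * t) (hω : orderOf ω = 4 * t) (h : T ∈ Subgroup.zpowers ω) :
    (T ^ t = ω ^ t ∧ T ^ (2 * t) = ω ^ (2 * t) ∧ T ^ (3 * t) = ω ^ (3 * t)) ∨
      (T ^ t = ω ^ (3 * t) ∧ T ^ (2 * t) = ω ^ (2 * t) ∧ T ^ (3 * t) = ω ^ t) := by
  have hfin : IsOfFinOrder ω := orderOf_pos_iff.mp (by omega)
  obtain ⟨a, rfl⟩ := hfin.mem_powers_iff_mem_zpowers.mpr h
  have hω1 : ω ^ (4 * t) = 1 := hω ▸ pow_orderOf_eq_one ω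
  have reduce : ∀ b c : ℕ, ω ^ (4 * t * b + c) = ω ^ c := fun b c ↦ by
    rw [pow_add, pow_mul, hω1, one_pow, one_mul]
  simp only [← pow_mul] at hT ⊢
  have hcases : a % 4 = 1 ∨ a % 4 = 3 ∨ a % 2 = 0 := by omega
  rcases hcases with ha | ha | ha
  · obtain ⟨b, rfl⟩ : ∃ b, a = 4 * b + 1 := ⟨a / 4, by omega⟩
    left
    refine ⟨?_, ?_, ?_⟩
    · rw [← reduce b t]; ring_nf
    · rw [← reduce (2 * b) (2 * t)]; ring_nf
    · rw [← reduce (3 * b) (3 * t)]; ring_nf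
  · obtain ⟨b, rfl⟩ : ∃ b, a = 4 * b + 3 := ⟨a / 4, by omega⟩
    right
    refine ⟨?_, ?_, ?_⟩
    · rw [← reduce b (3 * t)]; ring_nf
    · rw [← reduce (2 * b + 1) (2 * t)]; ring_nf
    · rw [← reduce (3 * b + 2) t]; ring_nf
  · obtain ⟨b, rfl⟩ : ∃ b, a = 2 * b := ⟨a / 2, by omega⟩
    have h1 : (ω ^ (2 * b)) ^ (2 * t) = 1 := by
      rw [← pow_mul, ← pow_zero ω, ← reduce b 0]; ring_nf
    have := Nat.le_of_dvd (by omega) (hT ▸ orderOf_dvd_of_pow_eq_one h1)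
    omega
/-- Corollary 3.4: for `p ≡ 1 (mod 4)` prime, `t = (p-1)/4`, and `T` a generator of the group
of multiplicative characters of `F_p^×` with values in `ℂ_p` (formalized as an algebraically
closed complete nontrivially normed field extension `K` of `ℚ_p`): for every `x ∈ F_p^×` with
integer lift `x̂`,
`₃F₂(1/4, 2/4, 3/4; 1, 1 | x̂)_{tr(p)} ≡ p² · ₃F₂(T^t, T^{2t}, T^{3t}; ε, ε | x)ₚ (mod p)`,
the congruence holding in the valuation ring (difference of norm at most `1/p`). -/
theorem classical_3F2_congruent_greene_3F2
    (p : ℕ) [Fact p.Prime] (hp4 : p % 4 = 1)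
    (K : Type*) [NontriviallyNormedField K] [IsAlgClosed K]
    [NormedAlgebra ℚ_[p] K] [CompleteSpace K]
    (t : ℕ) (ht : t = (p - 1) / 4)
    (T : MulChar (ZMod p) K) (hT : ∀ χ : MulChar (ZMod p) K, χ ∈ Subgroup.zpowers T)
    (x : ZMod p) (hx : x ≠ 0) (xh : ℤ) (hxh : (xh : ZMod p) = x) :
    ‖((∑ k ∈ Finset.range p,
          risingFac (1/4) k * risingFac (2/4) k * risingFac (3/4) k /
            (risingFac 1 k * risingFac 1 k * (k.factorial : ℚ)) * (xh : ℚ) ^ k : ℚ) : K) -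
        (p : K) ^ 2 * greene3F2 (T ^ t) (T ^ (2 * t)) (T ^ (3 * t)) 1 1 x‖ ≤ (p : ℝ)⁻¹ := by
  subst ht
  obtain ⟨t, hpt⟩ : ∃ t, p - 1 = 4 * t := ⟨(p - 1) / 4, by omega⟩
  have hp2 := (Fact.out : p.Prime).two_le
  have ht0 : 0 < t := by omega
  rw [show (p - 1) / 4 = t by omega]
  have : CharZero K := charZero_of_injective_algebraMap (algebraMap ℚ_[p] K).injective
  obtain ⟨ω, hω⟩ := exists_mulChar_padicInt_lift p
  let φ : ℤ_[p] →+* K := (algebraMap ℚ_[p] K).comp PadicInt.Coe.ringHom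
  have hφ : Function.Injective φ := (algebraMap ℚ_[p] K).injective.comp Subtype.val_injective
  have hφn : ∀ z, ‖φ z‖ = ‖z‖ := fun z ↦ norm_algebraMap' K (z : ℚ_[p])
  have hord : orderOf (ω.ringHomComp φ) = p - 1 := by
    rw [orderOf_ringHomComp hφ, orderOf_eq_of_toZMod_apply hω]
  have hcard : Nat.card (MulChar (ZMod p) K) = p - 1 := by
    have : NeZero (Monoid.exponent (ZMod p)ˣ : K) :=
      ⟨Nat.cast_ne_zero.mpr (Monoid.exponent_ne_zero_of_finite)⟩
    rw [MulChar.card_eq_card_units_of_hasEnoughRootsOfUnity, Nat.card_eq_fintype_card,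
      ZMod.card_units]
  have hgen : ∀ χ : MulChar (ZMod p) K, χ ∈ Subgroup.zpowers (ω.ringHomComp φ) := by
    intro χ
    rw [Subgroup.eq_top_of_card_eq (Subgroup.zpowers (ω.ringHomComp φ))
      (by rw [Nat.card_zpowers, hord, hcard])]
    exact Subgroup.mem_top χ
  have hTord : orderOf T = p - 1 := by
    rw [orderOf_eq_card_of_forall_mem_zpowers hT, hcard]
  have hG : greene3F2 (T ^ t) (T ^ (2 * t)) (T ^ (3 * t)) 1 1 x =
      greene3F2 (ω.ringHomComp φ ^ (p - 1 - t)) (ω.ringHomComp φ ^ (p - 1 - 2 * t))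
        (ω.ringHomComp φ ^ (p - 1 - 3 * t)) 1 1 x := by
    rw [show p - 1 - t = 3 * t by omega, show p - 1 - 2 * t = 2 * t by omega,
      show p - 1 - 3 * t = t by omega]
    rcases pow_mem_quarter_powers ht0 (hTord.trans hpt) (hord.trans hpt) (hgen T) with h | h
    · rw [h.1, h.2.1, h.2.2, greene3F2_one_one_reverse]
    · rw [h.1, h.2.1, h.2.2]
  obtain ⟨S, hS, hSG⟩ := exists_padicInt_greene3F2 φ hω hgen hord (s₀ := t) (s₁ := 2 * t)
    (s₂ := 3 * t) (by omega) (by omega) (by omega) (by omega) (by omega) (by omega) hx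
  have hcoef : ∀ n k : ℕ, k < p → ∃ z : ℤ_[p],
      φ z = ((risingFac (n / (4 : ℕ)) k / k.factorial : ℚ) : K) ∧
        PadicInt.toZMod z = (-1) ^ k * ((n * t).choose k : ℕ) := by
    intro n k hk
    refine exists_padicInt_risingFac_div_factorial φ (by norm_num) (by omega) ?_ hk
    rw [show 4 * (n * t) + n = p * n by
      rw [show p = 4 * t + 1 by omega]; ring]
    simp
  choose! z hz hzr using hcoef
  have hL : ((∑ k ∈ Finset.range p, risingFac (1/4) k * risingFac (2/4) k * risingFac (3/4) k /
      (risingFac 1 k * risingFac 1 k * (k.factorial : ℚ)) * (xh : ℚ) ^ k : ℚ) : K) =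
      φ (∑ k ∈ range p, z 1 k * z 2 k * z 3 k * (xh : ℤ_[p]) ^ k) := by
    rw [map_sum, Rat.cast_sum]
    refine Finset.sum_congr rfl fun k hk ↦ ?_
    rw [mem_range] at hk
    have h1 : risingFac 1 k = k.factorial := by
      rw [risingFac, ← Finset.prod_range_add_one_eq_factorial]
      push_cast
      exact Finset.prod_congr rfl fun i _ ↦ add_comm _ _
    simp only [map_mul, map_pow, map_intCast, hz _ k hk, h1]
    push_cast
    field_simp
  have hzero : PadicInt.toZMod (((p : ℤ_[p]) - 1) *
      (∑ k ∈ range p, z 1 k * z 2 k * z 3 k * (xh : ℤ_[p]) ^ k) - S) = 0 := by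
    have hlast : ((t.choose (p - 1) : ℕ) : ZMod p) = 0 := by
      rw [Nat.choose_eq_zero_of_lt (by omega), Nat.cast_zero]
    have hsum : PadicInt.toZMod (∑ k ∈ range p, z 1 k * z 2 k * z 3 k * (xh : ℤ_[p]) ^ k) =
        -PadicInt.toZMod S := by
      rw [hS, neg_neg, map_sum, show range p = range (p - 1 + 1) by congr 1; omega,
        Finset.sum_range_succ]
      have hred : ∀ k < p, PadicInt.toZMod (z 1 k * z 2 k * z 3 k * (xh : ℤ_[p]) ^ k) =
          ((-1) ^ k * (t.choose k : ℕ)) * ((-1) ^ k * ((2 * t).choose k : ℕ)) *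
            ((-1) ^ k * ((3 * t).choose k : ℕ)) * x ^ k := fun k hk ↦ by
        simp only [map_mul, map_pow, map_intCast, hzr _ k hk, hxh, one_mul]
      rw [hred (p - 1) (by omega), hlast, mul_zero, zero_mul, zero_mul, zero_mul, add_zero]
      exact Finset.sum_congr rfl fun k hk ↦ hred k (by rw [mem_range] at hk; omega)
    rw [map_sub, map_mul, hsum, map_sub, map_natCast, map_one, ZMod.natCast_self]
    ring
  have hn1 : ‖((p : K) - 1)‖ = 1 := by
    have : ((p : K) - 1) = φ ((p - 1 : ℕ) : ℤ_[p]) := by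
      rw [map_natCast, Nat.cast_sub (by omega), Nat.cast_one]
    rw [this, hφn, PadicInt.norm_natCast_eq_one_iff]
    exact (Nat.coprime_of_lt_prime (by omega) (by omega) Fact.out)
  rw [← one_mul ‖_ - _‖, ← hn1, ← norm_mul, mul_sub, hG, hSG, hL]
  have := PadicInt.norm_le_inv_of_toZMod_eq_zero hzero
  rw [← hφn] at this
  simpa using this
end
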